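/- For every integer ℓ ≥ 1, twice the Gromov–Hausdorff distance between S^1 and S^{2ℓ} equals 2πℓ/(2ℓ+1); that is, the infimum over all correspondences R ⊆ S^1 × S^{2ℓ} of dis(R) equals 2πℓ/(2ℓ+1). -/

import Mathlib

open Real

noncomputable section

/-- Euclidean space ℝ^d. -/
abbrev Euc (d : ℕ) : Type := EuclideanSpace ℝ (Fin d)

/-- The unit sphere S^n = {x ∈ ℝ^{n+1} : ⟨x,x⟩ = 1}. -/
def usphere (n : ℕ) : Set (Euc (n+1)) := {x | @inner ℝ _ _ x x = (1:ℝ)}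

/-- The geodesic distance d(x,y) = arccos⟨x,y⟩. -/
def geoDist {d : ℕ} (x y : Euc d) : ℝ := Real.arccos (@inner ℝ _ _ x y)

/-- A correspondence between A ⊆ ℝ^{d₁} and B ⊆ ℝ^{d₂}: a relation R ⊆ A × B whose
coordinate projections to A and B are both surjective. -/
def IsCorrespondence {d₁ d₂ : ℕ} (A : Set (Euc d₁)) (B : Set (Euc d₂))
    (R : Set (Euc d₁ × Euc d₂)) : Prop :=
  (∀ z ∈ R, z.1 ∈ A ∧ z.2 ∈ B) ∧
  (∀ a ∈ A, ∃ b ∈ B, (a, b) ∈ R) ∧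
  (∀ b ∈ B, ∃ a ∈ A, (a, b) ∈ R)

/-- The distortion of a relation, with respect to the geodesic metrics:
dis(R) = sup |d(x,x') − d(y,y')| over (x,y), (x',y') ∈ R. -/
def distortion {d₁ d₂ : ℕ} (R : Set (Euc d₁ × Euc d₂)) : ℝ :=
  sSup {t | ∃ z ∈ R, ∃ w ∈ R, t = |geoDist z.1 w.1 - geoDist z.2 w.2|}

/-- Twice the Gromov–Hausdorff distance between S^n and S^k (geodesic metrics),
via the Kalton–Ostrovskii formula: the infimum of dis(R) over all correspondences R. -/
def twoGH (n k : ℕ) : ℝ :=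
  sInf {t | ∃ R : Set (Euc (n+1) × Euc (k+1)),
    IsCorrespondence (usphere n) (usphere k) R ∧ t = distortion R}

/-- The mod 2 simplicial coboundary on cochains of ordered tuples. -/
def coboundary {V : Type*} : (List V → ZMod 2) → List V → ZMod 2
  | _, [] => 0
  | φ, a :: l => φ l + coboundary (fun t => φ (a :: t)) l

/-- The mod 2 prism operator between the vertex maps `f` and `g`. -/
def prism {V : Type*} (f g : V → V) : (List V → ZMod 2) → List V → ZMod 2
  | _, [] => 0
  | φ, a :: l => φ (f a :: g a :: l.map g) + prism f g (fun t => φ (f a :: t)) l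

lemma coboundary_add {V : Type*} (l : List V) : ∀ φ ψ : List V → ZMod 2,
    coboundary (fun t => φ t + ψ t) l = coboundary φ l + coboundary ψ l := by
  induction l with
  | nil => simp [coboundary]
  | cons a l ih => intro φ ψ; simp only [coboundary, ih]; ring

lemma coboundary_map {V W : Type*} (h : V → W) (l : List V) : ∀ φ : List W → ZMod 2,
    coboundary (fun t => φ (t.map h)) l = coboundary φ (l.map h) := by
  induction l with
  | nil => simp [coboundary]
  | cons a l ih =>
    intro φ
    simp only [coboundary, List.map_cons]
    rw [← ih]

lemma coboundary_congr {V : Type*} (l : List V) : ∀ φ ψ : List V → ZMod 2,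
    (∀ t, t.Sublist l → φ t = ψ t) → coboundary φ l = coboundary ψ l := by
  induction l with
  | nil => simp [coboundary]
  | cons a l ih =>
    intro φ ψ h
    simp only [coboundary]
    rw [h l (List.sublist_cons_self a l), ih _ (fun t => ψ (a :: t))
      fun t ht => h _ (ht.cons_cons a)]

lemma coboundary_perm {V : Type*} {l l' : List V} (h : l.Perm l') : ∀ φ : List V → ZMod 2,
    (∀ t t', t.Perm t' → φ t = φ t') → coboundary φ l = coboundary φ l' := by
  induction h with
  | nil => simp
  | cons a h ih =>
    intro φ hφ
    simp only [coboundary]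
    rw [hφ _ _ h, ih _ fun t t' ht => hφ _ _ (ht.cons a)]
  | swap a b l =>
    intro φ hφ
    simp only [coboundary]
    have : (fun t => φ (b :: a :: t)) = fun t => φ (a :: b :: t) :=
      funext fun t => hφ _ _ (List.Perm.swap a b t)
    rw [this]; ring
  | trans _ _ ih₁ ih₂ => intro φ hφ; rw [ih₁ φ hφ, ih₂ φ hφ]

lemma prism_add {V : Type*} (f g : V → V) (l : List V) : ∀ φ ψ : List V → ZMod 2,
    prism f g (fun t => φ t + ψ t) l = prism f g φ l + prism f g ψ l := by
  induction l with
  | nil => simp [prism]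
  | cons a l ih => intro φ ψ; simp only [prism, ih]; ring

lemma prism_congr {V : Type*} (f g : V → V) (l : List V) : ∀ φ ψ : List V → ZMod 2,
    (∀ l₁ a l₂, l = l₁ ++ a :: l₂ → φ (l₁.map f ++ f a :: g a :: l₂.map g) =
      ψ (l₁.map f ++ f a :: g a :: l₂.map g)) → prism f g φ l = prism f g ψ l := by
  induction l with
  | nil => simp [prism]
  | cons a l ih =>
    intro φ ψ h
    simp only [prism]
    have h₀ := h [] a l rfl
    simp only [List.map_nil, List.nil_append] at h₀
    rw [h₀, ih _ (fun t => ψ (f a :: t)) fun l₁ b l₂ hl => ?_]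
    simpa using h (a :: l₁) b l₂ (by rw [hl]; rfl)

lemma prism_coboundary {V : Type*} (f g : V → V) (l : List V) : ∀ φ : List V → ZMod 2,
    prism f g (coboundary φ) l =
      coboundary (prism f g φ) l + (φ (l.map g) + φ (l.map f)) := by
  induction l with
  | nil => intro φ; simp [prism, coboundary, CharTwo.add_self_eq_zero]
  | cons a l ih =>
    intro φ
    simp only [prism, coboundary, List.map_cons]
    rw [coboundary_add l (fun t => φ (f a :: g a :: t.map g)) (prism f g fun t => φ (f a :: t)),
      coboundary_map g l (fun t => φ (f a :: g a :: t)), prism_add, ih]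
    linear_combination CharTwo.add_self_eq_zero (φ (f a :: List.map g l))

/-- Evaluation of cochains on the mod 2 chain obtained from the point `x₀` by repeatedly adding
the image under `ν` and sweeping along the discrete homotopies `f k 0, …, f k M`. -/
def sweep {V : Type*} (ν : V → V) (f : ℕ → ℕ → V → V) (M : ℕ) (x₀ : V) :
    ℕ → (List V → ZMod 2) → ZMod 2
  | 0, φ => φ [x₀]
  | k + 1, φ => ∑ i ∈ Finset.range M, sweep ν f M x₀ k fun l =>
      prism (f k i) (f k (i + 1)) φ l + prism (f k i) (f k (i + 1)) φ (l.map ν)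

section sweep
variable {V : Type*} {ν : V → V} {f : ℕ → ℕ → V → V} {M : ℕ} {x₀ : V}

lemma sweep_add (k : ℕ) : ∀ φ ψ : List V → ZMod 2,
    sweep ν f M x₀ k (fun l => φ l + ψ l) = sweep ν f M x₀ k φ + sweep ν f M x₀ k ψ := by
  induction k with
  | zero => simp [sweep]
  | succ k ih =>
    intro φ ψ
    simp only [sweep, ← Finset.sum_add_distrib, ← ih, prism_add]
    refine Finset.sum_congr rfl fun i _ => congrArg _ (funext fun l => ?_)
    ring

lemma sweep_zero (k : ℕ) : sweep ν f M x₀ k (fun _ => 0) = 0 := by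
  have := sweep_add (ν := ν) (f := f) (M := M) (x₀ := x₀) k (fun _ => 0) (fun _ => 0)
  simpa using this

lemma sweep_congr {Q : ℕ → List V → Prop} {n : ℕ} (h₀ : Q 0 [x₀])
    (hν : ∀ k l, Q k l → Q k (l.map ν))
    (hf : ∀ k < n, ∀ i l₁ a l₂, Q k (l₁ ++ a :: l₂) →
      Q (k + 1) (l₁.map (f k i) ++ f k i a :: f k (i + 1) a :: l₂.map (f k (i + 1))))
    (k : ℕ) (hk : k ≤ n) : ∀ φ ψ : List V → ZMod 2, (∀ l, Q k l → φ l = ψ l) →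
      sweep ν f M x₀ k φ = sweep ν f M x₀ k ψ := by
  induction k with
  | zero => exact fun φ ψ h => h _ h₀
  | succ k ih =>
    intro φ ψ h
    simp only [sweep]
    refine Finset.sum_congr rfl fun i _ => ih (by omega) _ _ fun l hl => ?_
    have key : ∀ l, Q k l → prism (f k i) (f k (i + 1)) φ l = prism (f k i) (f k (i + 1)) ψ l :=
      fun l hl => prism_congr _ _ _ _ _ fun l₁ a l₂ e => h _ (hf k (by omega) i _ _ _ (e ▸ hl))
    rw [key l hl, key _ (hν k l hl)]

lemma sweep_coboundary (hν : ∀ x, ν (ν x) = x) (hf₀ : ∀ k x, f k 0 x = x)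
    (hfM : ∀ k x y, f k M x = f k M y) (k : ℕ) : ∀ φ : List V → ZMod 2,
      sweep ν f M x₀ (k + 1) (coboundary φ) =
        sweep ν f M x₀ k fun l => φ l + φ (l.map ν) := by
  have hνν : ∀ l : List V, (l.map ν).map ν = l := fun l => by
    simp [Function.comp_def, hν]
  have step : ∀ k, (∀ ψ : List V → ZMod 2, sweep ν f M x₀ k
      (fun l => coboundary ψ l + coboundary ψ (l.map ν)) = 0) → ∀ φ : List V → ZMod 2,
      sweep ν f M x₀ (k + 1) (coboundary φ) =
        sweep ν f M x₀ k fun l => φ l + φ (l.map ν) := by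
    intro k hcyc φ
    have h₁ : ∀ i, (sweep ν f M x₀ k fun l =>
        prism (f k i) (f k (i + 1)) (coboundary φ) l +
          prism (f k i) (f k (i + 1)) (coboundary φ) (l.map ν)) =
        (sweep ν f M x₀ k fun l => φ (l.map (f k (i + 1))) + φ ((l.map ν).map (f k (i + 1)))) -
        (sweep ν f M x₀ k fun l => φ (l.map (f k i)) + φ ((l.map ν).map (f k i))) := by
      intro i
      rw [CharTwo.sub_eq_add, ← sweep_add]
      rw [← zero_add (sweep ν f M x₀ k _), ← hcyc (prism (f k i) (f k (i + 1)) φ), ← sweep_add]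
      refine congrArg _ (funext fun l => ?_)
      rw [prism_coboundary, prism_coboundary]
      linear_combination
        CharTwo.add_self_eq_zero (coboundary (prism (f k i) (f k (i + 1)) φ) l) +
          CharTwo.add_self_eq_zero (coboundary (prism (f k i) (f k (i + 1)) φ) (l.map ν))
    rw [sweep, Finset.sum_congr rfl fun i _ => h₁ i, Finset.sum_range_sub
      (fun i => sweep ν f M x₀ k fun l => φ (l.map (f k i)) + φ ((l.map ν).map (f k i)))]
    have h₂ : (fun l : List V => φ (l.map (f k M)) + φ ((l.map ν).map (f k M))) = fun _ => 0 := by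
      funext l
      have : (l.map ν).map (f k M) = l.map (f k M) := by
        rw [List.map_map]
        exact List.map_congr_left fun x _ => hfM k _ _
      rw [this, CharTwo.add_self_eq_zero]
    have h₃ : f k 0 = id := funext (hf₀ k)
    rw [h₂, sweep_zero, CharTwo.sub_eq_add, zero_add, h₃]
    simp
  refine step k ?_
  have e : ∀ ψ : List V → ZMod 2, (fun l => coboundary ψ l + coboundary ψ (l.map ν)) =
      coboundary fun l => ψ l + ψ (l.map ν) := fun ψ => funext fun l => by
    rw [coboundary_add, coboundary_map ν l ψ]
  induction k with
  | zero => intro ψ; simp [sweep, coboundary, CharTwo.add_self_eq_zero]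
  | succ k ih =>
    intro ψ
    rw [e, step k ih]
    rw [← sweep_zero (ν := ν) (f := f) (M := M) (x₀ := x₀) k]
    refine congrArg _ (funext fun l => ?_)
    rw [hνν, add_comm (ψ (l.map ν)), CharTwo.add_self_eq_zero]

end sweep

/-- The indicator that a list of signs alternates and starts with the given sign. -/
def altSign : Bool → List Bool → ZMod 2
  | _, [] => 1
  | s, a :: l => if a = s then altSign (!s) l else 0

lemma altSign_map_not (l : List Bool) : ∀ s, altSign s (l.map not) = altSign (!s) l := by
  induction l with
  | nil => simp [altSign]
  | cons a l ih =>
    intro s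
    simp only [altSign, List.map_cons, ih]
    cases a <;> cases s <;> simp

lemma coboundary_altSign (l : List Bool) : ∀ s,
    coboundary (altSign s) l = altSign s l + altSign (!s) l := by
  induction l with
  | nil => intro s; simp [altSign, coboundary, CharTwo.add_self_eq_zero]
  | cons a l ih =>
    intro s
    by_cases h : a = s
    · subst h
      simp only [coboundary, altSign, if_true, ih]
      rw [Bool.not_not, if_neg (by cases a <;> simp)]
      linear_combination CharTwo.add_self_eq_zero (altSign a l)
    · have h' : a = !s := by cases a <;> cases s <;> simp_all
      subst h'
      simp only [coboundary, altSign, if_true, Bool.not_not, if_neg h]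
      have : coboundary (fun _ : List Bool => (0 : ZMod 2)) l = 0 := by
        simpa using coboundary_add l (fun _ => 0) (fun _ => 0)
      rw [this]; ring

/-- The sign component of a label. -/
abbrev labelSign (a : ℝ ×ₗ Bool) : Bool := (ofLex a).2

/-- The indicator that a list of labels, once sorted, has alternating signs. -/
noncomputable def sortedAlt (s : Bool) (m : List (ℝ ×ₗ Bool)) : ZMod 2 :=
  altSign s ((m.insertionSort (· ≤ ·)).map labelSign)

lemma insertionSort_eq_of_perm {α : Type*} [LinearOrder α] {l l' : List α} (h : l.Perm l') :
    l.insertionSort (· ≤ ·) = l'.insertionSort (· ≤ ·) :=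
  List.Perm.eq_of_sortedLE List.sortedLE_insertionSort List.sortedLE_insertionSort
    ((List.perm_insertionSort _ l).trans (h.trans (List.perm_insertionSort _ l').symm))

lemma coboundary_sortedAlt (s : Bool) (m : List (ℝ ×ₗ Bool)) :
    coboundary (sortedAlt s) m = sortedAlt s m + sortedAlt (!s) m := by
  rw [coboundary_perm (List.perm_insertionSort (· ≤ ·) m).symm _ fun t t' h => by
    rw [sortedAlt, sortedAlt, insertionSort_eq_of_perm h]]
  rw [coboundary_congr _ _ (fun t => altSign s (t.map labelSign)) fun t ht => ?_]
  · rw [coboundary_map, coboundary_altSign]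
    rfl
  · have : t.Pairwise (· ≤ ·) := (List.pairwise_insertionSort (· ≤ ·) m).sublist ht
    rw [sortedAlt, this.insertionSort_eq]

lemma sortedAlt_map_flip (s : Bool) (m : List (ℝ ×ₗ Bool))
    (h : ∀ a ∈ m, ∀ b ∈ m, (ofLex a).1 = (ofLex b).1 → labelSign a = labelSign b) :
    sortedAlt s (m.map fun a => toLex ((ofLex a).1, !labelSign a)) = sortedAlt (!s) m := by
  rw [sortedAlt, ← List.map_insertionSort (· ≤ ·), List.map_map, sortedAlt, ← altSign_map_not,
    List.map_map]
  · rfl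
  · intro a ha b hb
    rw [Prod.Lex.le_iff, Prod.Lex.le_iff]
    simp only [ofLex_toLex]
    refine or_congr Iff.rfl (and_congr_right fun e => ?_)
    have := h a ha b hb e
    simp only [labelSign] at this ⊢
    rw [this]; simp

lemma norm_cos_smul_add_sin_smul {d : ℕ} {x y : Euc d} (hx : ‖x‖ = 1) (hy : ‖y‖ = 1)
    (hxy : inner ℝ x y = 0) (t : ℝ) : ‖cos t • x + sin t • y‖ = 1 := by
  have h : ‖cos t • x + sin t • y‖ * ‖cos t • x + sin t • y‖ = 1 := by
    rw [norm_add_sq_eq_norm_sq_add_norm_sq_real]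
    · rw [norm_smul, norm_smul, hx, hy, Real.norm_eq_abs, Real.norm_eq_abs]
      simp only [mul_one, abs_mul_abs_self]
      nlinarith [Real.sin_sq_add_cos_sq t]
    · rw [inner_smul_left, inner_smul_right, hxy]
      simp
  nlinarith [norm_nonneg (cos t • x + sin t • y)]

/-- A form of Ky Fan's lemma: a labelling of the sphere by signed real numbers which is odd and
has no complementary labels on nearby points is alternating on some small simplex. -/
theorem exists_alternating (n : ℕ) (θ : Euc (n + 1) → ℝ) (b : Euc (n + 1) → Bool)
    (hθ : ∀ x, ‖x‖ = 1 → θ (-x) = θ x) (hb : ∀ x, ‖x‖ = 1 → b (-x) = !b x) (ε : ℝ) (hε : 0 < ε)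
    (hc : ∀ x y, ‖x‖ = 1 → ‖y‖ = 1 → ‖x - y‖ ≤ ε → θ x = θ y → b x = b y) :
    ∃ (m : List (ℝ ×ₗ Bool)) (s : Bool), m.length = n + 1 ∧ m.Pairwise (· ≤ ·) ∧
      altSign s (m.map labelSign) ≠ 0 ∧
      ∀ a ∈ m, ∀ a' ∈ m, ∃ x y, ‖x‖ = 1 ∧ ‖y‖ = 1 ∧ ‖x - y‖ ≤ ε ∧
        a = toLex (θ x, b x) ∧ a' = toLex (θ y, b y) := by
  classical
  set e : ℕ → Euc (n + 1) := fun j =>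
    if h : j < n + 1 then EuclideanSpace.single ⟨j, h⟩ 1 else 0 with he
  have he₁ : ∀ j ≤ n, ‖e j‖ = 1 := fun j hj => by simp [he, hj]
  have he₂ : ∀ i j, i ≠ j → inner ℝ (e i) (e j) = 0 := fun i j hij => by
    simp only [he]
    split_ifs <;> simp [EuclideanSpace.inner_single_left, hij]
  obtain ⟨M, hM⟩ : ∃ M : ℕ, 2 * π * n / ε + 1 < M := exists_nat_gt _
  have hM₀ : (0 : ℝ) < M := by
    have : 0 ≤ 2 * π * n / ε := by positivity
    linarith
  set η : ℝ := 2 * (π / (2 * M)) with hη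
  have hη₀ : 0 ≤ η := by positivity
  have hηε : n * η ≤ ε := by
    have h : 2 * π * n / ε < M := by linarith
    rw [div_lt_iff₀ hε] at h
    have : n * η = π * n / M := by rw [hη]; field_simp
    rw [this, div_le_iff₀ hM₀]
    nlinarith [Real.pi_pos, (Nat.cast_nonneg n : (0 : ℝ) ≤ n), mul_pos hM₀ hε]
  set t : ℕ → ℝ := fun i => i * (π / (2 * M)) with ht
  set f : ℕ → ℕ → Euc (n + 1) → Euc (n + 1) := fun k i x =>
    Real.cos (t i) • x + Real.sin (t i) • e (k + 1) with hf
  set Q : ℕ → List (Euc (n + 1)) → Prop := fun k l => l.length = k + 1 ∧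
    (∀ x ∈ l, ‖x‖ = 1 ∧ ∀ j > k, inner ℝ x (e j) = 0) ∧
    ∀ x ∈ l, ∀ y ∈ l, ‖x - y‖ ≤ k * η with hQ
  have hQ₀ : Q 0 [e 0] := by
    refine ⟨rfl, ?_, ?_⟩
    · simp only [List.mem_singleton, forall_eq]
      exact ⟨he₁ 0 (Nat.zero_le _), fun j hj => he₂ 0 j (by omega)⟩
    · simp
  have hQν : ∀ k l, Q k l → Q k (l.map fun x => -x) := by
    rintro k l ⟨h₁, h₂, h₃⟩
    refine ⟨by simpa using h₁, ?_, ?_⟩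
    · simp only [List.mem_map, forall_exists_index, and_imp, forall_apply_eq_imp_iff₂]
      intro x hx
      simpa using h₂ x hx
    · simp only [List.mem_map, forall_exists_index, and_imp, forall_apply_eq_imp_iff₂]
      intro x hx y hy
      rw [neg_sub_neg]
      exact h₃ y hy x hx
  have hLip : ∀ k i x y, ‖f k i x - f k i y‖ ≤ ‖x - y‖ := by
    intro k i x y
    simp only [hf, add_sub_add_right_eq_sub, ← smul_sub, norm_smul, Real.norm_eq_abs]
    exact mul_le_of_le_one_left (norm_nonneg _) (Real.abs_cos_le_one _)
  have htt : ∀ i, |t i - t (i + 1)| = π / (2 * M) := fun i => by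
    have h : t i - t (i + 1) = -(π / (2 * M)) := by simp only [ht]; push_cast; ring
    rw [h, abs_neg, abs_of_nonneg (by positivity)]
  have hstep : ∀ k i x, k + 1 ≤ n → ‖x‖ = 1 → ‖f k i x - f k (i + 1) x‖ ≤ η := by
    intro k i x hk hx
    have h : f k i x - f k (i + 1) x = (Real.cos (t i) - Real.cos (t (i + 1))) • x +
        (Real.sin (t i) - Real.sin (t (i + 1))) • e (k + 1) := by
      simp only [hf]; module
    rw [h, hη, two_mul, ← htt i]
    refine (norm_add_le _ _).trans (add_le_add ?_ ?_)
    · rw [norm_smul, hx, mul_one, Real.norm_eq_abs]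
      exact Real.abs_cos_sub_cos_le _ _
    · rw [norm_smul, he₁ _ hk, mul_one, Real.norm_eq_abs]
      exact Real.abs_sin_sub_sin_le _ _
  have hQf : ∀ k < n, ∀ i l₁ a l₂, Q k (l₁ ++ a :: l₂) →
      Q (k + 1) (l₁.map (f k i) ++ f k i a :: f k (i + 1) a :: l₂.map (f k (i + 1))) := by
    rintro k hk i l₁ a l₂ ⟨h₁, h₂, h₃⟩
    have hmem : ∀ z ∈ l₁.map (f k i) ++ f k i a :: f k (i + 1) a :: l₂.map (f k (i + 1)),
        ∃ x ∈ l₁ ++ a :: l₂, z = f k i x ∨ z = f k (i + 1) x := by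
      intro z hz
      simp only [List.mem_append, List.mem_map, List.mem_cons] at hz ⊢
      rcases hz with ⟨x, hx, rfl⟩ | rfl | rfl | ⟨x, hx, rfl⟩
      · exact ⟨x, Or.inl hx, Or.inl rfl⟩
      · exact ⟨a, Or.inr (Or.inl rfl), Or.inl rfl⟩
      · exact ⟨a, Or.inr (Or.inl rfl), Or.inr rfl⟩
      · exact ⟨x, Or.inr (Or.inr hx), Or.inr rfl⟩
    have hgood : ∀ i, ∀ x ∈ l₁ ++ a :: l₂, ‖f k i x‖ = 1 ∧
        ∀ j > k + 1, inner ℝ (f k i x) (e j) = 0 := by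
      intro i x hx
      obtain ⟨hx₁, hx₂⟩ := h₂ x hx
      refine ⟨?_, fun j hj => ?_⟩
      · exact norm_cos_smul_add_sin_smul hx₁ (he₁ _ hk) (hx₂ _ (Nat.lt_succ_self k)) _
      · simp only [hf]
        rw [inner_add_left, inner_smul_left, inner_smul_left, hx₂ j (by omega),
          he₂ (k + 1) j (by omega)]
        simp
    refine ⟨by simp at h₁ ⊢; omega, fun z hz => ?_, fun z hz z' hz' => ?_⟩
    · obtain ⟨x, hx, rfl | rfl⟩ := hmem z hz
      · exact hgood _ x hx
      · exact hgood _ x hx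
    · obtain ⟨x, hx, hzx⟩ := hmem z hz
      obtain ⟨y, hy, hzy⟩ := hmem z' hz'
      have hxy := h₃ x hx y hy
      have hy₁ := hstep k i y hk (h₂ y hy).1
      push_cast
      rcases hzx with rfl | rfl <;> rcases hzy with rfl | rfl
      · linarith [hLip k i x y]
      · linarith [hLip k i x y, norm_sub_le_norm_sub_add_norm_sub (f k i x) (f k i y)
          (f k (i + 1) y)]
      · rw [norm_sub_rev] at hy₁
        linarith [hLip k (i + 1) x y, norm_sub_le_norm_sub_add_norm_sub (f k (i + 1) x)
          (f k (i + 1) y) (f k i y)]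
      · linarith [hLip k (i + 1) x y]
  have hcob := fun k => sweep_coboundary (ν := fun x : Euc (n + 1) => -x) (f := f) (M := M)
    (x₀ := e 0) neg_neg (fun k x => by simp [hf, ht])
    (fun k x y => by
      have : t M = π / 2 := by simp only [ht]; field_simp
      simp [hf, this]) k
  set lab : Euc (n + 1) → ℝ ×ₗ Bool := fun x => toLex (θ x, b x) with hlab
  have hcong := sweep_congr (M := M) (f := f) hQ₀ hQν hQf
  set ψ : List (Euc (n + 1)) → ZMod 2 := fun l =>
    sortedAlt true (l.map lab) + sortedAlt false (l.map lab) with hψ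
  have hone : ∀ k ≤ n, sweep (fun x : Euc (n + 1) => -x) f M (e 0) k ψ = 1 := by
    intro k
    induction k with
    | zero =>
      intro _
      simp only [sweep, hψ, sortedAlt, List.map_cons, List.map_nil, List.insertionSort_cons,
        List.insertionSort_nil, List.orderedInsert_nil, altSign]
      cases labelSign (lab (e 0)) <;> simp
    | succ k ih =>
      intro hk
      have : ψ = coboundary fun l => sortedAlt true (l.map lab) := by
        funext l
        rw [coboundary_map, coboundary_sortedAlt]
        rfl
      rw [this, hcob, ← ih (by omega)]
      refine hcong k (by omega) _ _ fun l hl => ?_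
      simp only [hψ]
      congr 1
      rw [← Bool.not_true, ← sortedAlt_map_flip]
      · congr 1
        rw [List.map_map, List.map_map]
        refine List.map_congr_left fun x hx => ?_
        simp [hlab, labelSign, hθ x (hl.2.1 x hx).1, hb x (hl.2.1 x hx).1]
      · simp only [List.mem_map, forall_exists_index, and_imp, forall_apply_eq_imp_iff₂]
        intro x hx y hy hxy
        refine hc x y (hl.2.1 x hx).1 (hl.2.1 y hy).1 ((hl.2.2 x hx y hy).trans ?_) hxy
        refine le_trans ?_ hηε
        have : (k : ℝ) ≤ n := by exact_mod_cast (by omega : k ≤ n)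
        gcongr
  have hex : ∃ l, Q n l ∧ ψ l ≠ 0 := by
    by_contra! h
    have h₀ := hcong n le_rfl ψ (fun _ => 0) h
    rw [hone n le_rfl, sweep_zero] at h₀
    exact one_ne_zero h₀
  obtain ⟨l, ⟨hl₁, hl₂, hl₃⟩, hl⟩ := hex
  obtain ⟨s, hs⟩ : ∃ s, sortedAlt s (l.map lab) ≠ 0 := by
    by_contra! h
    exact hl (by simp [hψ, h])
  refine ⟨(l.map lab).insertionSort (· ≤ ·), s, by simpa using hl₁,
    List.pairwise_insertionSort _ _, hs, ?_⟩
  simp only [List.mem_insertionSort, List.mem_map, forall_exists_index, and_imp,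
    forall_apply_eq_imp_iff₂]
  intro x hx y hy
  exact ⟨x, y, (hl₂ x hx).1, (hl₂ y hy).1, (hl₃ x hx y hy).trans hηε, rfl, rfl⟩

lemma exists_far_of_altSign (K : ℝ) (m : List (ℝ ×ₗ Bool)) : ∀ (a : ℝ ×ₗ Bool) (s : Bool),
    altSign s ((a :: m).map labelSign) ≠ 0 → (a :: m).Pairwise (· ≤ ·) →
    (∀ x ∈ a :: m, ∀ y ∈ a :: m, (ofLex x).1 ≤ (ofLex y).1 → labelSign x ≠ labelSign y →
      K ≤ (ofLex y).1 - (ofLex x).1) →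
    ∃ z ∈ a :: m, m.length * K ≤ (ofLex z).1 - (ofLex a).1 ∧
      (labelSign z = labelSign a ↔ Even m.length) := by
  induction m with
  | nil => intro a s _ _ _; exact ⟨a, by simp⟩
  | cons c m ih =>
    intro a s halt hp hK
    rw [List.map_cons, altSign, ite_ne_right_iff] at halt
    obtain ⟨rfl, halt⟩ := halt
    obtain ⟨z, hz, hz₁, hz₂⟩ := ih c _ halt hp.of_cons
      fun x hx y hy => hK x (List.mem_cons_of_mem _ hx) y (List.mem_cons_of_mem _ hy)
    rw [List.map_cons, altSign, ite_ne_right_iff] at halt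
    have hac : a ≤ c := List.rel_of_pairwise_cons hp (List.mem_cons_self ..)
    have hac' : (ofLex a).1 ≤ (ofLex c).1 := by
      rw [Prod.Lex.le_iff] at hac
      rcases hac with h | h
      · exact h.le
      · exact h.1.le
    have hlt := hK a (by simp) c (by simp) hac' (by rw [halt.1]; cases labelSign a <;> simp)
    refine ⟨z, List.mem_cons_of_mem _ hz, ?_, ?_⟩
    · rw [List.length_cons]; push_cast; linarith
    · rw [List.length_cons, Nat.even_add_one, ← hz₂, halt.1]
      cases labelSign z <;> cases labelSign a <;> simp

lemma mem_usphere_iff {n : ℕ} {x : Euc (n + 1)} : x ∈ usphere n ↔ ‖x‖ = 1 := by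
  rw [usphere, Set.mem_ofPred_eq, real_inner_self_eq_norm_sq]
  exact pow_eq_one_iff_of_nonneg (norm_nonneg x) two_ne_zero

/-- The point of the unit circle with the given angle. -/
def circlePt (t : ℝ) : Euc 2 := !₂[Real.cos t, Real.sin t]

lemma circlePt_mem (t : ℝ) : circlePt t ∈ usphere 1 := by
  rw [mem_usphere_iff, EuclideanSpace.norm_eq, Fin.sum_univ_two]
  simp [circlePt]

lemma circlePt_add_pi (t : ℝ) : circlePt (t + π) = -circlePt t := by
  ext i
  fin_cases i <;> simp [circlePt]

lemma circlePt_add_int_mul (t : ℝ) (n : ℤ) : circlePt (t + n * (2 * π)) = circlePt t := by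
  ext i
  fin_cases i <;> simp [circlePt]

lemma geoDist_circlePt (s t : ℝ) : geoDist (circlePt s) (circlePt t) = arccos (cos (s - t)) := by
  rw [geoDist, Real.cos_sub]
  congr 1
  simp only [circlePt, PiLp.inner_apply, Fin.sum_univ_two]
  simp [mul_comm]

lemma exists_circlePt {p : Euc 2} (hp : p ∈ usphere 1) :
    ∃ t, -π < t ∧ t ≤ π ∧ p = circlePt t := by
  have h₁ : p 0 * p 0 + p 1 * p 1 = 1 := by
    have h : ‖p‖ ^ 2 = 1 := by rw [mem_usphere_iff.1 hp, one_pow]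
    rw [EuclideanSpace.real_norm_sq_eq, Fin.sum_univ_two] at h
    linarith
  have h₂ : ‖(⟨p 0, p 1⟩ : ℂ)‖ = 1 := by
    rw [Complex.norm_def, Complex.normSq_mk, h₁, Real.sqrt_one]
  have h₃ : (⟨p 0, p 1⟩ : ℂ) ≠ 0 := by
    rw [← norm_ne_zero_iff, h₂]; exact one_ne_zero
  refine ⟨Complex.arg ⟨p 0, p 1⟩, Complex.neg_pi_lt_arg _, Complex.arg_le_pi _, ?_⟩
  ext i
  fin_cases i
  · simp [circlePt, Complex.cos_arg h₃, h₂]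
  · simp [circlePt, Complex.sin_arg, h₂]

lemma geoDist_neg_left {d : ℕ} (x y : Euc d) : geoDist (-x) y = π - geoDist x y := by
  rw [geoDist, inner_neg_left, Real.arccos_neg, geoDist]

lemma geoDist_neg_right {d : ℕ} (x y : Euc d) : geoDist x (-y) = π - geoDist x y := by
  rw [geoDist, inner_neg_right, Real.arccos_neg, geoDist]

lemma neg_mem_usphere {n : ℕ} {x : Euc (n + 1)} (h : x ∈ usphere n) : -x ∈ usphere n := by
  rw [mem_usphere_iff] at h ⊢; rwa [norm_neg]

/-- The vector `v`, negated if the sign is `true`. -/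
def signed {d : ℕ} (s : Bool) (v : Euc d) : Euc d := if s then -v else v

lemma geoDist_signed {d : ℕ} (s t : Bool) (x y : Euc d) :
    geoDist (signed s x) (signed t y) = if s = t then geoDist x y else π - geoDist x y := by
  cases s <;> cases t <;> simp [signed, geoDist_neg_left, geoDist_neg_right]

lemma abs_geoDist_signed_sub {d d' : ℕ} (s t : Bool) (p q : Euc d) (x y : Euc d') :
    |geoDist (signed s p) (signed t q) - geoDist (signed s x) (signed t y)| =
      |geoDist p q - geoDist x y| := by
  rw [geoDist_signed, geoDist_signed]
  split_ifs
  · rfl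
  · rw [← abs_neg]; congr 1; ring

lemma abs_geoDist_sub_le_pi {d d' : ℕ} (p q : Euc d) (x y : Euc d') :
    |geoDist p q - geoDist x y| ≤ π :=
  abs_sub_le_of_nonneg_of_le (Real.arccos_nonneg _) (Real.arccos_le_pi _)
    (Real.arccos_nonneg _) (Real.arccos_le_pi _)

lemma exists_signed_circlePt {p : Euc 2} (hp : p ∈ usphere 1) :
    ∃ (t : ℝ) (s : Bool), 0 ≤ t ∧ t < π ∧ p = signed s (circlePt t) := by
  obtain ⟨t, h₁, h₂, rfl⟩ := exists_circlePt hp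
  rcases lt_or_ge t 0 with h | h
  · exact ⟨t + π, true, by linarith, by linarith, by simp [signed, circlePt_add_pi]⟩
  · rcases h₂.lt_or_eq with h' | rfl
    · exact ⟨t, false, h, h', by simp [signed]⟩
    · exact ⟨0, true, le_rfl, Real.pi_pos, by simpa [signed] using circlePt_add_pi 0⟩

/-- Every relation onto the sphere is, up to antipodal symmetry, the graph of an odd map in polar
coordinates. -/
lemma exists_odd_polar {n : ℕ} {R : Set (Euc 2 × Euc (n + 1))}
    (hR : IsCorrespondence (usphere 1) (usphere n) R) :
    ∃ (θ : Euc (n + 1) → ℝ) (b : Euc (n + 1) → Bool), ∀ x, ‖x‖ = 1 →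
      θ (-x) = θ x ∧ b (-x) = (!b x) ∧ 0 ≤ θ x ∧ θ x < π ∧
      ∃ s, (signed s (signed (b x) (circlePt (θ x))), signed s x) ∈ R := by
  classical
  have h₁ : ∀ x : Euc (n + 1), ∃ (t : ℝ) (s : Bool), ‖x‖ = 1 →
      0 ≤ t ∧ t < π ∧ (signed s (circlePt t), x) ∈ R := by
    intro x
    by_cases hx : ‖x‖ = 1
    · obtain ⟨p, hp, hpx⟩ := hR.2.2 x (mem_usphere_iff.2 hx)
      obtain ⟨t, s, h₀, h₁, rfl⟩ := exists_signed_circlePt hp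
      exact ⟨t, s, fun _ => ⟨h₀, h₁, hpx⟩⟩
    · exact ⟨0, false, fun h => absurd h hx⟩
  choose t s hts using h₁
  have hsplit : ∀ x : Euc (n + 1), ‖x‖ = 1 →
      (WellOrderingRel x (-x) ∧ ¬ WellOrderingRel (-x) x) ∨
      (¬ WellOrderingRel x (-x) ∧ WellOrderingRel (-x) x) := by
    intro x hx
    have hne : x ≠ -x := fun h => by
      have h₂ : (2 : ℝ) • x = 0 := by rw [two_smul, add_eq_zero_iff_eq_neg]; exact h
      rw [smul_eq_zero_iff_right two_ne_zero] at h₂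
      simp [h₂] at hx
    have htri : WellOrderingRel x (-x) ∨ WellOrderingRel (-x) x := by
      by_contra! h
      exact hne (Std.Trichotomous.trichotomous (r := WellOrderingRel) x (-x) h.1 h.2)
    rcases htri with h | h
    · exact Or.inl ⟨h, asymm h⟩
    · exact Or.inr ⟨asymm h, h⟩
  refine ⟨fun x => if WellOrderingRel x (-x) then t x else t (-x),
    fun x => if WellOrderingRel x (-x) then s x else !s (-x), fun x hx => ?_⟩
  have hx' : ‖-x‖ = 1 := by rwa [norm_neg]
  rcases hsplit x hx with ⟨h, h'⟩ | ⟨h, h'⟩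
  · simp only [neg_neg, h, h', if_true, if_false, true_and]
    exact ⟨(hts x hx).1, (hts x hx).2.1, false, by simpa [signed] using (hts x hx).2.2⟩
  · simp only [neg_neg, h, h', if_true, if_false, true_and, Bool.not_not]
    refine ⟨(hts _ hx').1, (hts _ hx').2.1, true, ?_⟩
    convert (hts _ hx').2.2 using 2
    · cases s (-x) <;> simp [signed]
    · simp [signed]

lemma arccos_cos_eq_abs {t : ℝ} (h : |t| ≤ π) : arccos (cos t) = |t| := by
  rw [← Real.cos_abs, Real.arccos_cos (abs_nonneg _) h]

lemma exists_norm_sub_le_geoDist_le {d : ℕ} {ε : ℝ} (hε : 0 < ε) (hεπ : ε < π) :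
    ∃ η > 0, ∀ x y : Euc d, ‖x‖ = 1 → ‖y‖ = 1 → ‖x - y‖ ≤ η → geoDist x y ≤ ε := by
  have hc : cos ε < 1 := by
    simpa using Real.cos_lt_cos_of_nonneg_of_le_pi le_rfl hεπ.le hε
  refine ⟨1 - cos ε, by linarith, fun x y hx hy hxy => ?_⟩
  rw [geoDist, ← Real.arccos_cos hε.le hεπ.le]
  refine Real.arccos_le_arccos ?_
  have := norm_sub_sq_real x y
  rw [hx, hy] at this
  nlinarith [norm_nonneg (x - y), Real.neg_one_le_cos ε]

theorem le_distortion (ℓ : ℕ) {R : Set (Euc 2 × Euc (2 * ℓ + 1))}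
    (hR : IsCorrespondence (usphere 1) (usphere (2 * ℓ)) R) :
    2 * π * ℓ / (2 * (ℓ : ℝ) + 1) ≤ distortion R := by
  have hle : ∀ z ∈ R, ∀ w ∈ R, |geoDist z.1 w.1 - geoDist z.2 w.2| ≤ distortion R := by
    intro z hz w hw
    refine le_csSup ⟨π, ?_⟩ ⟨z, hz, w, hw, rfl⟩
    rintro _ ⟨z, _, w, _, rfl⟩
    exact abs_geoDist_sub_le_pi _ _ _ _
  obtain ⟨p, -, hp⟩ := hR.2.1 _ (circlePt_mem 0)
  have hR₀ : 0 ≤ distortion R := (abs_nonneg _).trans (hle _ hp _ hp)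
  by_contra! hlt
  obtain ⟨K, hK₁, hK₂⟩ := exists_between hlt
  rw [lt_div_iff₀ (by positivity)] at hK₂
  have hKπ : K < π := by
    have : (0 : ℝ) ≤ ℓ := Nat.cast_nonneg _
    nlinarith [Real.pi_pos]
  obtain ⟨θ, b, hθb⟩ := exists_odd_polar hR
  obtain ⟨η, hη, hnear⟩ := exists_norm_sub_le_geoDist_le (d := 2 * ℓ + 1)
    (sub_pos.2 hK₁) (by linarith)
  have hdist : ∀ x y : Euc (2 * ℓ + 1), ‖x‖ = 1 → ‖y‖ = 1 → ‖x - y‖ ≤ η →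
      (if b x = b y then |θ x - θ y| else π - |θ x - θ y|) ≤ K := by
    intro x y hx hy hxy
    obtain ⟨-, -, hx₀, hxπ, s, hs⟩ := hθb x hx
    obtain ⟨-, -, hy₀, hyπ, s', hs'⟩ := hθb y hy
    have h := hle _ hs _ hs'
    rw [abs_geoDist_signed_sub, geoDist_signed, geoDist_circlePt,
      arccos_cos_eq_abs (abs_sub_le_of_nonneg_of_le hx₀ hxπ.le hy₀ hyπ.le)] at h
    linarith [le_of_abs_le h, hnear x y hx hy hxy]
  obtain ⟨m, s, hm, hsort, halt, hmem⟩ := exists_alternating (2 * ℓ) θ b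
    (fun x hx => (hθb x hx).1) (fun x hx => (hθb x hx).2.1) η hη
    (fun x y hx hy hxy h => by
      by_contra hne
      have := hdist x y hx hy hxy
      rw [if_neg hne, h, sub_self, abs_zero] at this
      linarith)
  obtain ⟨a, m, rfl⟩ : ∃ a m', m = a :: m' := List.exists_cons_of_length_eq_add_one hm
  obtain ⟨z, hz, hz₁, hz₂⟩ := exists_far_of_altSign (π - K) m a s halt hsort
    (fun c hc c' hc' hcc hne => by
      obtain ⟨x, y, hx, hy, hxy, rfl, rfl⟩ := hmem c hc c' hc'
      have := hdist x y hx hy hxy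
      simp only [labelSign, ofLex_toLex] at hne hcc ⊢
      rw [if_neg hne, abs_sub_comm, abs_of_nonneg (by linarith)] at this
      linarith)
  have hm' : m.length = 2 * ℓ := by simpa using hm
  obtain ⟨x, y, hx, hy, hxy, rfl, rfl⟩ := hmem z hz a (List.mem_cons_self ..)
  have hxy' := hdist x y hx hy hxy
  rw [hm'] at hz₁ hz₂
  have hxy_sign : b x = b y := hz₂.2 (even_two_mul ℓ)
  rw [if_pos hxy_sign] at hxy'
  push_cast at hz₁
  simp only [ofLex_toLex] at hz₁
  nlinarith [le_abs_self (θ x - θ y)]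

lemma geoDist_eq_angle {d : ℕ} {x y : Euc d} (hx : ‖x‖ = 1) (hy : ‖y‖ = 1) :
    geoDist x y = InnerProductGeometry.angle x y := by
  rw [geoDist, InnerProductGeometry.angle, hx, hy, mul_one, div_one]

lemma geoDist_triangle {d : ℕ} {x y z : Euc d} (hx : ‖x‖ = 1) (hy : ‖y‖ = 1) (hz : ‖z‖ = 1) :
    geoDist x z ≤ geoDist x y + geoDist y z := by
  rw [geoDist_eq_angle hx hz, geoDist_eq_angle hx hy, geoDist_eq_angle hy hz]
  exact InnerProductGeometry.angle_le_angle_add_angle x y z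

lemma geoDist_comm {d : ℕ} (x y : Euc d) : geoDist x y = geoDist y x := by
  rw [geoDist, real_inner_comm, geoDist]

lemma abs_geoDist_sub_le {d : ℕ} {x y z : Euc d} (hx : ‖x‖ = 1) (hy : ‖y‖ = 1) (hz : ‖z‖ = 1) :
    |geoDist x z - geoDist y z| ≤ geoDist x y := by
  rw [abs_sub_le_iff]
  constructor
  · linarith [geoDist_triangle hx hy hz]
  · linarith [geoDist_triangle hy hx hz, geoDist_comm x y]

lemma arccos_cos_eq_min {t : ℝ} (h : |t| ≤ 2 * π) :
    arccos (cos t) = min |t| (2 * π - |t|) := by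
  rcases le_total |t| π with h' | h'
  · rw [arccos_cos_eq_abs h', min_eq_left (by linarith)]
  · rw [min_eq_right (by linarith), ← Real.cos_abs, ← Real.cos_two_pi_sub,
      Real.arccos_cos (by linarith) (by linarith)]

lemma arccos_cos_le_abs (t : ℝ) : arccos (cos t) ≤ |t| := by
  rcases le_total |t| π with h | h
  · exact (arccos_cos_eq_abs h).le
  · exact (Real.arccos_le_pi _).trans h

/-- The unit vector with equal positive coordinates. -/
def northPole (d : ℕ) : Euc d := WithLp.toLp 2 fun _ => (√d)⁻¹

lemma inner_northPole {d : ℕ} (x : Euc d) :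
    inner ℝ x (northPole d) = (∑ j, x j) * (√d)⁻¹ := by
  rw [PiLp.inner_apply, Finset.sum_mul]
  simp [northPole, mul_comm]

lemma norm_northPole {d : ℕ} (hd : 0 < d) : ‖northPole d‖ = 1 := by
  have h : (0 : ℝ) < d := by exact_mod_cast hd
  rw [EuclideanSpace.norm_eq, Real.sqrt_eq_one]
  simp [northPole, Real.sq_sqrt h.le, h.ne']

lemma sum_nonneg_of_inner_northPole {d : ℕ} (hd : 0 < d) {x : Euc d}
    (h : 0 ≤ inner ℝ x (northPole d)) : 0 ≤ ∑ j, x j := by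
  have h' : (0 : ℝ) < d := by exact_mod_cast hd
  rw [inner_northPole] at h
  exact nonneg_of_mul_nonneg_left h (by positivity)

/-- Two unit vectors in the closed upper hemisphere whose largest coordinates have the same index
are not too far apart. -/
lemma neg_div_le_inner {ℓ : ℕ} {x y : Euc (2 * ℓ + 1)} (hx : ‖x‖ = 1) (hy : ‖y‖ = 1)
    (hxs : 0 ≤ ∑ j, x j) (hys : 0 ≤ ∑ j, y j) (hℓ : 1 ≤ ℓ) (i : Fin (2 * ℓ + 1))
    (hxi : ∀ j, x j ≤ x i) (hyi : ∀ j, y j ≤ y i) :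
    -(ℓ / (ℓ + 1) : ℝ) ≤ inner ℝ x y := by
  have hx₂ : ∑ j, x j ^ 2 = 1 := by rw [← EuclideanSpace.real_norm_sq_eq, hx, one_pow]
  have hy₂ : ∑ j, y j ^ 2 = 1 := by rw [← EuclideanSpace.real_norm_sq_eq, hy, one_pow]
  have hc : inner ℝ x y = ∑ j, x j * y j := by
    rw [PiLp.inner_apply]; simp [mul_comm]
  rw [hc]
  set c := ∑ j, x j * y j
  set S := ∑ j, x j
  set T := ∑ j, y j
  set d : ℝ := 2 * ℓ + 1 with hd
  have hℓ' : (1 : ℝ) ≤ ℓ := by exact_mod_cast hℓ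
  have h₁ : 0 ≤ d * (x i * y i) - x i * T - y i * S + c := by
    have h : 0 ≤ ∑ j, (x i - x j) * (y i - y j) := Finset.sum_nonneg fun j _ =>
      mul_nonneg (sub_nonneg.2 (hxi j)) (sub_nonneg.2 (hyi j))
    have h' : ∑ j, (x i - x j) * (y i - y j) = d * (x i * y i) - x i * T - y i * S + c := by
      have : ∀ j, (x i - x j) * (y i - y j) =
          x i * y i - x i * y j - y i * x j + x j * y j := fun j => by ring
      simp only [this, Finset.sum_add_distrib, Finset.sum_sub_distrib, ← Finset.mul_sum]
      simp only [Finset.sum_const, Finset.card_univ, Fintype.card_fin, nsmul_eq_mul, hd, c, S, T]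
      push_cast
      ring
    rwa [h'] at h
  have h₂ : (S + T - (x i + y i)) ^ 2 ≤ 2 * ℓ * (2 + 2 * c - (x i + y i) ^ 2) := by
    have h := sq_sum_le_card_mul_sum_sq (s := Finset.univ.erase i) (f := fun j => x j + y j)
    have e₁ : ∑ j ∈ Finset.univ.erase i, (x j + y j) = S + T - (x i + y i) := by
      rw [Finset.sum_erase_eq_sub (Finset.mem_univ i), Finset.sum_add_distrib]
    have e₂ : ∑ j ∈ Finset.univ.erase i, (x j + y j) ^ 2 = 2 + 2 * c - (x i + y i) ^ 2 := by
      rw [Finset.sum_erase_eq_sub (Finset.mem_univ i)]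
      have : ∀ j, (x j + y j) ^ 2 = x j ^ 2 + y j ^ 2 + 2 * (x j * y j) := fun j => by ring
      simp only [this, Finset.sum_add_distrib, ← Finset.mul_sum, hx₂, hy₂]
      ring
    rw [e₁, e₂, Finset.card_erase_of_mem (Finset.mem_univ i)] at h
    simpa using h
  set a := x i - S / d with ha
  set b := y i - T / d with hb
  have hd₀ : 0 < d := by positivity
  have hST : 0 ≤ S * T / d := by positivity
  have h₁' : -(c - S * T / d) ≤ d * (a * b) := by
    have : d * (a * b) = d * (x i * y i) - x i * T - y i * S + S * T / d := by
      rw [ha, hb]; field_simp; ring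
    linarith
  have h₂' : d * (a + b) ^ 2 + 2 * ℓ * ((S + T) ^ 2 / d) ≤ 2 * ℓ * (2 + 2 * c) := by
    have e : d * (a + b) ^ 2 + 2 * ℓ * ((S + T) ^ 2 / d) =
        (S + T - (x i + y i)) ^ 2 + 2 * ℓ * (x i + y i) ^ 2 := by
      have h : (2 * ℓ : ℝ) = d - 1 := by rw [hd]; ring
      rw [h, ha, hb]; field_simp; ring
    rw [e]; linarith
  have h₃ : 4 * (S * T / d) ≤ (S + T) ^ 2 / d := by
    rw [mul_div_assoc']
    gcongr
    nlinarith [sq_nonneg (S - T)]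
  have h₄ : -(4 * (c - S * T / d)) ≤ 2 * ℓ * (2 + 2 * (c - S * T / d)) := by
    nlinarith [mul_nonneg hd₀.le (sq_nonneg (a - b)), mul_le_mul_of_nonneg_left h₃
      (by positivity : (0 : ℝ) ≤ 2 * ℓ), mul_nonneg hST (by positivity : (0 : ℝ) ≤ ℓ)]
  rw [neg_le, le_div_iff₀ (by positivity)]
  nlinarith

lemma div_succ_le_cos {ℓ : ℕ} (hℓ : 1 ≤ ℓ) :
    (ℓ / (ℓ + 1) : ℝ) ≤ cos (π / (2 * ℓ + 1)) := by
  rcases hℓ.eq_or_lt with rfl | h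
  · norm_num
  · have hℓ' : (2 : ℝ) ≤ ℓ := by exact_mod_cast h
    refine le_trans ?_ (Real.one_sub_sq_div_two_le_cos (x := π / (2 * ℓ + 1)))
    have hπ : π ^ 2 < 10 := by nlinarith [Real.pi_lt_d2, Real.pi_pos]
    rw [div_pow, div_div, div_le_iff₀ (by positivity), sub_mul, div_mul_eq_mul_div, le_sub_comm,
      div_le_iff₀ (by positivity)]
    nlinarith

lemma geoDist_le_of_same_argmax {ℓ : ℕ} {x y : Euc (2 * ℓ + 1)} (hx : ‖x‖ = 1) (hy : ‖y‖ = 1)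
    (hxs : 0 ≤ ∑ j, x j) (hys : 0 ≤ ∑ j, y j) (hℓ : 1 ≤ ℓ) (i : Fin (2 * ℓ + 1))
    (hxi : ∀ j, x j ≤ x i) (hyi : ∀ j, y j ≤ y i) :
    geoDist x y ≤ π - π / (2 * ℓ + 1) := by
  have hw : π / (2 * ℓ + 1) ≤ π := div_le_self Real.pi_pos.le (by norm_cast; omega)
  rw [← Real.arccos_cos (by positivity) hw, ← Real.arccos_neg]
  refine Real.arccos_le_arccos ?_
  exact (neg_le_neg (div_succ_le_cos hℓ)).trans (neg_div_le_inner hx hy hxs hys hℓ i hxi hyi)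

/-- The distance to the north pole, truncated at `w` and centred. -/
def height {d : ℕ} (w : ℝ) (x : Euc d) : ℝ := min (geoDist x (northPole d)) w - w / 2

lemma abs_height_sub_le {d : ℕ} (hd : 0 < d) (w : ℝ) {x y : Euc d} (hx : ‖x‖ = 1)
    (hy : ‖y‖ = 1) : |height w x - height w y| ≤ geoDist x y := by
  rw [height, height, sub_sub_sub_cancel_right]
  refine (abs_min_sub_min_le_max ..).trans ?_
  rw [sub_self, abs_zero, max_eq_left (abs_nonneg _)]
  exact abs_geoDist_sub_le hx hy (norm_northPole hd)

lemma abs_height_le {d : ℕ} {w : ℝ} (hw : 0 ≤ w) (x : Euc d) : |height w x| ≤ w / 2 := by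
  rw [height, abs_le]
  have : 0 ≤ min (geoDist x (northPole d)) w := le_min (Real.arccos_nonneg _) hw
  constructor <;> linarith [min_le_right (geoDist x (northPole d)) w]

/-- The correspondence sending the part of the upper hemisphere where the `i`-th coordinate is
largest to an arc around the `i`-th vertex of a regular polygon, extended antipodally. -/
def cellRelation (ℓ : ℕ) : Set (Euc 2 × Euc (2 * ℓ + 1)) :=
  {z | ∃ (x : Euc (2 * ℓ + 1)) (i : Fin (2 * ℓ + 1)) (s : Bool), ‖x‖ = 1 ∧
    0 ≤ inner ℝ x (northPole (2 * ℓ + 1)) ∧ (∀ j, x j ≤ x i) ∧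
    z = (signed s (circlePt (2 * (π / (2 * ℓ + 1)) * i + height (π / (2 * ℓ + 1)) x)),
      signed s x)}

lemma arccos_cos_polygon_le {ℓ : ℕ} {i j : ℕ} (hi : i < 2 * ℓ + 1) (hj : j < 2 * ℓ + 1) :
    arccos (cos (2 * (π / (2 * ℓ + 1)) * i - 2 * (π / (2 * ℓ + 1)) * j)) ≤
      π - π / (2 * ℓ + 1) := by
  wlog hij : j ≤ i generalizing i j
  · rw [← Real.cos_neg, neg_sub]
    exact this hj hi (by omega)
  obtain ⟨k, rfl⟩ := Nat.exists_eq_add_of_le hij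
  set w := π / (2 * ℓ + 1) with hw
  have hπ : π = (2 * ℓ + 1) * w := by rw [hw]; field_simp
  have hw₀ : 0 < w := by positivity
  have e : 2 * w * ((j + k : ℕ) : ℝ) - 2 * w * j = 2 * w * k := by push_cast; ring
  have hk : (k : ℝ) ≤ 2 * ℓ := by exact_mod_cast (by omega : k ≤ 2 * ℓ)
  rw [e, arccos_cos_eq_min, abs_of_nonneg (by positivity)]
  · rcases Nat.lt_or_ge ℓ k with h | h
    · have h' : (ℓ : ℝ) + 1 ≤ k := by exact_mod_cast h
      refine (min_le_right _ _).trans ?_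
      rw [hπ]; nlinarith
    · have h' : (k : ℝ) ≤ ℓ := by exact_mod_cast h
      refine (min_le_left _ _).trans ?_
      rw [hπ]; nlinarith
  · rw [abs_of_nonneg (by positivity), hπ]
    nlinarith

lemma le_arccos_cos_of_ne {ℓ : ℕ} {i j : ℕ} (hi : i < 2 * ℓ + 1) (hj : j < 2 * ℓ + 1)
    (hij : i ≠ j) {e : ℝ} (he : |e| ≤ π / (2 * ℓ + 1)) :
    π / (2 * ℓ + 1) ≤
      arccos (cos (2 * (π / (2 * ℓ + 1)) * i - 2 * (π / (2 * ℓ + 1)) * j + e)) := by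
  wlog hlt : j < i generalizing i j e
  · rw [← Real.cos_neg, neg_add, neg_sub]
    exact this hj hi hij.symm (by rwa [abs_neg]) (by omega)
  obtain ⟨k, rfl⟩ := Nat.exists_eq_add_of_lt hlt
  set w := π / (2 * ℓ + 1) with hw
  have hπ : π = (2 * ℓ + 1) * w := by rw [hw]; field_simp
  have hw₀ : 0 < w := by positivity
  have hk : (k : ℝ) + 1 ≤ 2 * ℓ := by exact_mod_cast (by omega : k + 1 ≤ 2 * ℓ)
  have e' : 2 * w * ((j + k + 1 : ℕ) : ℝ) - 2 * w * j + e = 2 * w * (k + 1) + e := by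
    push_cast; ring
  obtain ⟨he₁, he₂⟩ := abs_le.1 he
  have hk₀ : 0 ≤ w * k := by positivity
  have hk₁ : w * (k + 1) ≤ w * (2 * ℓ) := by gcongr
  have hpos : 0 ≤ 2 * w * (k + 1) + e := by linarith
  rw [e', arccos_cos_eq_min, abs_of_nonneg hpos]
  · refine le_min (by linarith) ?_
    rw [hπ]; linarith
  · rw [abs_of_nonneg hpos, hπ]; linarith

lemma abs_geoDist_cell_sub_le {ℓ : ℕ} (hℓ : 1 ≤ ℓ) {x y : Euc (2 * ℓ + 1)}
    {i j : Fin (2 * ℓ + 1)} (hx : ‖x‖ = 1) (hy : ‖y‖ = 1)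
    (hxN : 0 ≤ inner ℝ x (northPole (2 * ℓ + 1))) (hyN : 0 ≤ inner ℝ y (northPole (2 * ℓ + 1)))
    (hxi : ∀ k, x k ≤ x i) (hyj : ∀ k, y k ≤ y j) :
    |geoDist (circlePt (2 * (π / (2 * ℓ + 1)) * i + height (π / (2 * ℓ + 1)) x))
        (circlePt (2 * (π / (2 * ℓ + 1)) * j + height (π / (2 * ℓ + 1)) y)) - geoDist x y| ≤
      π - π / (2 * ℓ + 1) := by
  have hpoly := arccos_cos_polygon_le i.2 j.2
  have hfar := fun h e he => le_arccos_cos_of_ne (e := e) i.2 j.2 h he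
  have hsame := geoDist_le_of_same_argmax hx hy
    (sum_nonneg_of_inner_northPole (Nat.succ_pos _) hxN)
    (sum_nonneg_of_inner_northPole (Nat.succ_pos _) hyN) hℓ i hxi
  set w := π / (2 * (ℓ : ℝ) + 1) with hw
  have hw₀ : 0 < w := by positivity
  have hh := abs_height_sub_le (Nat.succ_pos _) w hx hy
  have hhw : |height w x - height w y| ≤ w := by
    have h₁ := abs_le.1 (abs_height_le hw₀.le x)
    have h₂ := abs_le.1 (abs_height_le hw₀.le y)
    rw [abs_le]; constructor <;> linarith
  have hP : ∀ t, ‖circlePt t‖ = 1 := fun t => mem_usphere_iff.1 (circlePt_mem t)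
  rw [abs_sub_le_iff]
  constructor
  · have h₁ := geoDist_triangle (hP (2 * w * i + height w x)) (hP (2 * w * j + height w x))
      (hP (2 * w * j + height w y))
    have h₂ : geoDist (circlePt (2 * w * i + height w x)) (circlePt (2 * w * j + height w x)) ≤
        π - w := by
      rwa [geoDist_circlePt, add_sub_add_right_eq_sub]
    have h₃ : geoDist (circlePt (2 * w * j + height w x)) (circlePt (2 * w * j + height w y)) ≤
        geoDist x y := by
      rw [geoDist_circlePt, add_sub_add_left_eq_sub]
      exact (arccos_cos_le_abs _).trans hh
    linarith
  · by_cases hij : i = j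
    · subst hij
      have h : 0 ≤ geoDist (circlePt (2 * w * i + height w x))
        (circlePt (2 * w * i + height w y)) := Real.arccos_nonneg _
      linarith [hsame hyj]
    · have h := hfar (fun h => hij (Fin.ext h)) _ hhw
      have hπ : geoDist x y ≤ π := Real.arccos_le_pi _
      rw [geoDist_circlePt, add_sub_add_comm]
      linarith

lemma distortion_cellRelation_le {ℓ : ℕ} (hℓ : 1 ≤ ℓ) :
    distortion (cellRelation ℓ) ≤ π - π / (2 * ℓ + 1) := by
  have h₀ : (0 : ℝ) ≤ π - π / (2 * ℓ + 1) :=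
    sub_nonneg.2 (div_le_self Real.pi_pos.le (by norm_cast; omega))
  refine Real.sSup_le ?_ h₀
  rintro _ ⟨_, ⟨x, i, s, hx, hxN, hxi, rfl⟩, _, ⟨y, j, s', hy, hyN, hyj, rfl⟩, rfl⟩
  rw [abs_geoDist_signed_sub]
  exact abs_geoDist_cell_sub_le hℓ hx hy hxN hyN hxi hyj

lemma signed_mem_usphere {n : ℕ} (s : Bool) {x : Euc (n + 1)} (h : x ∈ usphere n) :
    signed s x ∈ usphere n := by
  cases s
  · exact h
  · exact neg_mem_usphere h

/-- The cell with index `i` contains points at every small distance from the north pole. -/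
lemma exists_mem_cell {d : ℕ} (hd : 2 ≤ d) (i : Fin d) {ρ : ℝ} (h₀ : 0 ≤ ρ) (hρ : ρ ≤ π / 2) :
    ∃ x : Euc d, ‖x‖ = 1 ∧ 0 ≤ inner ℝ x (northPole d) ∧ (∀ j, x j ≤ x i) ∧
      geoDist x (northPole d) = ρ := by
  have hN := norm_northPole (show 0 < d by omega)
  have hd' : (2 : ℝ) ≤ d := by exact_mod_cast hd
  set q : Euc d := WithLp.toLp 2 fun j => if j = i then (d : ℝ) - 1 else -1 with hq
  have hqN : inner ℝ q (northPole d) = 0 := by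
    have h : ∑ j, q j = 0 := by
      have : ∀ j, q j = (if j = i then (d : ℝ) else 0) - 1 := fun j => by
        simp only [hq]; split_ifs <;> ring
      simp [this]
    rw [inner_northPole, h, zero_mul]
  have hqi : q i = d - 1 := by simp [hq]
  have hqj : ∀ j, q j ≤ q i := fun j => by
    rw [hqi]; simp only [hq]; split_ifs <;> linarith
  have hq₀ : q ≠ 0 := fun h => by
    rw [h] at hqi
    simp only [PiLp.zero_apply] at hqi
    linarith
  set p : Euc d := ‖q‖⁻¹ • q with hp
  have hp₁ : ‖p‖ = 1 := norm_smul_inv_norm hq₀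
  have hpN : inner ℝ (northPole d) p = 0 := by
    rw [hp, inner_smul_right, real_inner_comm, hqN, mul_zero]
  have hin : inner ℝ (cos ρ • northPole d + sin ρ • p) (northPole d) = cos ρ := by
    rw [inner_add_left, inner_smul_left, inner_smul_left, real_inner_comm, real_inner_comm,
      real_inner_self_eq_norm_sq, hN]
    rw [real_inner_comm, hpN]
    simp
  have hs : 0 ≤ sin ρ := Real.sin_nonneg_of_nonneg_of_le_pi h₀ (by linarith [Real.pi_pos])
  refine ⟨cos ρ • northPole d + sin ρ • p, norm_cos_smul_add_sin_smul hN hp₁ hpN ρ, ?_,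
    fun j => ?_, ?_⟩
  · rw [hin]; exact Real.cos_nonneg_of_neg_pi_div_two_le_of_le (by linarith) hρ
  · simp only [PiLp.add_apply, PiLp.smul_apply, smul_eq_mul, hp, northPole]
    gcongr
    exact hqj j
  · rw [geoDist, hin, Real.arccos_cos h₀ (by linarith [Real.pi_pos])]

lemma exists_polygon_decomposition (ℓ : ℕ) (t : ℝ) :
    ∃ (i : Fin (2 * ℓ + 1)) (s : Bool) (r : ℝ), |r| ≤ π / (2 * ℓ + 1) / 2 ∧
      circlePt t = signed s (circlePt (2 * (π / (2 * ℓ + 1)) * i + r)) := by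
  set w := π / (2 * (ℓ : ℝ) + 1) with hw
  have hw₀ : 0 < w := by positivity
  have hπ : π = (2 * ℓ + 1) * w := by rw [hw]; field_simp
  have hred : ∀ (q : ℤ) (r : ℝ), ∃ i : Fin (2 * ℓ + 1),
      circlePt (2 * w * q + r) = circlePt (2 * w * i + r) := by
    intro q r
    have hd : (0 : ℤ) < 2 * ℓ + 1 := by positivity
    have h₁ := Int.emod_nonneg q hd.ne'
    have h₂ := Int.emod_lt_of_pos q hd
    refine ⟨⟨(q % (2 * ℓ + 1)).toNat, by omega⟩, ?_⟩
    symm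
    rw [← circlePt_add_int_mul _ (q / (2 * ℓ + 1))]
    congr 1
    have h₃ : (((q % (2 * ℓ + 1)).toNat : ℕ) : ℝ) = ((q % (2 * ℓ + 1) : ℤ) : ℝ) := by
      exact_mod_cast congrArg (Int.cast (R := ℝ)) (Int.toNat_of_nonneg h₁)
    have h₄ : (q : ℝ) =
        ((q % (2 * ℓ + 1) : ℤ) : ℝ) + (2 * ℓ + 1) * ((q / (2 * ℓ + 1) : ℤ) : ℝ) := by
      exact_mod_cast (Int.emod_add_mul_ediv q (2 * ℓ + 1)).symm
    simp only [h₃]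
    linear_combination 2 * ((q / (2 * ℓ + 1) : ℤ) : ℝ) * hπ - 2 * w * h₄
  have hround : |t - round (t / w) * w| ≤ w / 2 := by
    have h := abs_sub_round (t / w)
    have e : t - round (t / w) * w = (t / w - round (t / w)) * w := by field_simp
    rw [e, abs_mul, abs_of_pos hw₀]
    nlinarith
  set k := round (t / w)
  rcases Int.even_or_odd' k with ⟨q, hk | hk⟩
  · obtain ⟨i, hi⟩ := hred q (t - k * w)
    refine ⟨i, false, t - k * w, hround, ?_⟩
    rw [signed, if_neg (by simp), ← hi]
    congr 1
    rw [hk]; push_cast; ring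
  · obtain ⟨i, hi⟩ := hred (q + ℓ + 1) (t - k * w)
    refine ⟨i, true, t - k * w, hround, ?_⟩
    rw [signed, if_pos rfl, ← hi, ← circlePt_add_pi, ← circlePt_add_int_mul t 1]
    congr 1
    rw [hk, hπ]; push_cast; ring

lemma isCorrespondence_cellRelation {ℓ : ℕ} (hℓ : 1 ≤ ℓ) :
    IsCorrespondence (usphere 1) (usphere (2 * ℓ)) (cellRelation ℓ) := by
  refine ⟨?_, fun p hp => ?_, fun y hy => ?_⟩
  · rintro _ ⟨x, i, s, hx, -, -, rfl⟩
    exact ⟨signed_mem_usphere s (circlePt_mem _), signed_mem_usphere s (mem_usphere_iff.2 hx)⟩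
  · obtain ⟨t, -, -, rfl⟩ := exists_circlePt hp
    obtain ⟨i, s, r, hr, h⟩ := exists_polygon_decomposition ℓ t
    have hw : π / (2 * ℓ + 1) ≤ π / 2 := by
      have : (1 : ℝ) ≤ ℓ := by exact_mod_cast hℓ
      gcongr
      linarith
    obtain ⟨hr₁, hr₂⟩ := abs_le.1 hr
    obtain ⟨x, hx, hxN, hxi, hxρ⟩ := exists_mem_cell (d := 2 * ℓ + 1) (by omega) i
      (ρ := r + π / (2 * ℓ + 1) / 2) (by linarith) (by linarith)
    refine ⟨signed s x, signed_mem_usphere s (mem_usphere_iff.2 hx), x, i, s, hx, hxN, hxi, ?_⟩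
    rw [h, height, hxρ, min_eq_left (by linarith), add_sub_cancel_right]
  · have hex : ∀ x : Euc (2 * ℓ + 1), ‖x‖ = 1 → 0 ≤ inner ℝ x (northPole (2 * ℓ + 1)) →
        ∀ s, ∃ p ∈ usphere 1, (p, signed s x) ∈ cellRelation ℓ := by
      intro x hx hxN s
      obtain ⟨i, hi⟩ := Finite.exists_max fun j => x j
      exact ⟨_, signed_mem_usphere s (circlePt_mem _), x, i, s, hx, hxN, hi, rfl⟩
    rw [mem_usphere_iff] at hy
    rcases le_total 0 (inner ℝ y (northPole (2 * ℓ + 1))) with h | h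
    · simpa [signed] using hex y hy h false
    · simpa [signed] using hex (-y) (by rwa [norm_neg]) (by rwa [inner_neg_left, neg_nonneg]) true

/-- For every integer ℓ ≥ 1, twice the Gromov–Hausdorff distance between S^1 and S^{2ℓ}
equals 2πℓ/(2ℓ+1). -/
theorem two_dGH_S1_even (ℓ : ℕ) (hℓ : 1 ≤ ℓ) :
    twoGH 1 (2 * ℓ) = 2 * π * ℓ / (2 * (ℓ : ℝ) + 1) := by
  have hmem := isCorrespondence_cellRelation hℓ
  have hval : π - π / (2 * ℓ + 1) = 2 * π * ℓ / (2 * (ℓ : ℝ) + 1) := by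
    field_simp
    ring
  rw [twoGH]
  refine le_antisymm ?_ (le_csInf ⟨_, _, hmem, rfl⟩ ?_)
  · refine csInf_le_of_le ⟨2 * π * ℓ / (2 * (ℓ : ℝ) + 1), ?_⟩ ⟨_, hmem, rfl⟩
      ((distortion_cellRelation_le hℓ).trans_eq hval)
    rintro _ ⟨R, hR, rfl⟩
    exact le_distortion ℓ hR
  · rintro _ ⟨R, hR, rfl⟩
    exact le_distortion ℓ hR
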